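/- arXiv:2007.13367 — 2 statements merged into one kernel-verified Lean document; each statement's English description precedes it below -/
import Mathlib

section
/- (Arithmetic analogue of Christol's theorem.) A Witt vector ξ ∈ W_{O_K}(O_K̄) is integral over O_K if and only if its orbit {ψ_𝔞 ξ : 𝔞 ∈ I_K} under the shift operators is a finite set. -/
open NumberField

set_option synthInstance.maxHeartbeats 1000000
set_option maxHeartbeats 1000000

def NZI (R : Type*) [CommRing R] [IsDomain R] : Submonoid (Ideal R) where
  carrier := {I | I ≠ ⊥}
  mul_mem' := by
    intro a b ha hb h
    rcases Ideal.mul_eq_bot.mp h with h' | h'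
    · exact ha h'
    · exact hb h'
  one_mem' := by
    simpa [Ideal.one_eq_top] using (top_ne_bot : (⊤ : Ideal R) ≠ ⊥)

def shiftI {R : Type*} [CommRing R] [IsDomain R] {A : Type*} (a : NZI R) (ξ : NZI R → A) :
    NZI R → A := fun b => ξ (a * b)

/-- A fixed algebraic closure of `K`. -/
abbrev Kbar (K : Type*) [Field K] := AlgebraicClosure K

variable (K : Type*) [Field K] [NumberField K]

/-- The sets `U_{O_K, n}(O_K̄)`, viewed inside `K̄^{I_K}`: `U_0` consists of the vectors all
of whose components lie in `O_K̄` (the integral closure of `O_K` in `K̄`), and `U_{n+1}`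
consists of those `ξ ∈ U_n` with `ψ_𝔭 ξ - ξ^{N𝔭} ∈ 𝔭·U_n` for all nonzero primes `𝔭`. -/
def USet : ℕ → Set (NZI (𝓞 K) → Kbar K)
  | 0 => {ξ | ∀ a, IsIntegral (𝓞 K) (ξ a)}
  | n + 1 =>
      {ξ | ξ ∈ USet n ∧ ∀ (p : Ideal (𝓞 K)) (_ : p.IsPrime) (hp : p ≠ ⊥),
        shiftI ⟨p, hp⟩ ξ - ξ ^ Ideal.absNorm p ∈
          Submodule.span (𝓞 K) {x | ∃ r ∈ p, ∃ η ∈ USet n, x = r • η}}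

/-- The set `W^a_{O_K}(O_K̄)` of integral Witt vectors: Witt vectors with coefficients in
`O_K̄` that are integral over `O_K`. -/
def WittA : Set (NZI (𝓞 K) → Kbar K) :=
  {ξ | (∀ n, ξ ∈ USet K n) ∧ IsIntegral (𝓞 K) ξ}

/-- The orbit `I_K Ξ = {ψ_𝔞 ξ : 𝔞 ∈ I_K, ξ ∈ Ξ}` of a set of vectors under the shifts. -/
def orbitSet (Ξ : Set (NZI (𝓞 K) → Kbar K)) : Set (NZI (𝓞 K) → Kbar K) :=
  {x | ∃ a : NZI (𝓞 K), ∃ ξ ∈ Ξ, x = shiftI a ξ}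

/-- The `K`-subalgebra `X_Ξ` of `K̄^{I_K}` generated by the orbit of `Ξ` under the shifts. -/
noncomputable def XXi (Ξ : Set (NZI (𝓞 K) → Kbar K)) :
    Subalgebra K (NZI (𝓞 K) → Kbar K) :=
  Algebra.adjoin K (orbitSet K Ξ)


theorem aux_pow {M S : Type*} [CommMonoid M] (y : M → S) (p : M) (N m : ℕ) (hm : 0 < m)
    (h : ∀ a, y (p ^ (N + m) * a) = y (p ^ N * a)) (k : ℕ) :
    ∃ j < N + m, ∀ a, y (p ^ k * a) = y (p ^ j * a) := by
  induction k using Nat.strong_induction_on with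
  | _ k ih =>
    by_cases hk : k < N + m
    · exact ⟨k, hk, fun a => rfl⟩
    · obtain ⟨j, hj, hh⟩ := ih (k - m) (by omega)
      refine ⟨j, hj, fun a => ?_⟩
      rw [← hh]
      have := h (p ^ (k - (N + m)) * a)
      rw [← mul_assoc, ← mul_assoc, ← pow_add, ← pow_add] at this
      rwa [show N + m + (k - (N + m)) = k by omega, show N + (k - (N+m)) = k - m by omega] at this

theorem aux_comb {M S : Type*} [CommMonoid M] [Finite S] (y : M → S) (Pr T : Set M)
    (hgen : Submonoid.closure Pr = ⊤) (hT : T.Finite)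
    (hgood : ∀ p ∈ Pr, p ∉ T → ∃ h : S → S, ∀ a, y (p * a) = h (y a))
    (hbad : ∀ p ∈ T, ∃ N m : ℕ, 0 < m ∧ ∀ a, y (p ^ (N + m) * a) = y (p ^ N * a)) :
    (Set.range (fun a : M => fun b : M => y (a * b))).Finite := by
  have h1 : ((fun a : M => fun b : M => y (a * b)) '' (Submonoid.closure T : Set M)).Finite := by
    clear hgood
    induction T, hT using Set.Finite.induction_on with
    | empty => simp
    | @insert p T hp hT ih =>
      obtain ⟨N, m, hm, h⟩ := hbad p (Set.mem_insert _ _)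
      have ih' := ih (fun p hp => hbad p (Set.mem_insert_of_mem _ hp))
      have h3 : (Set.image2 (fun (j : ℕ) (z : M → S) => fun b => z (p ^ j * b)) (Set.Iio (N + m))
        ((fun a : M => fun b : M => y (a * b)) '' (Submonoid.closure T : Set M))).Finite :=
        Set.Finite.image2 _ (Set.finite_Iio _) ih'
      refine h3.subset ?_
      rintro _ ⟨a, ha, rfl⟩
      rw [SetLike.mem_coe, Set.insert_eq, Submonoid.closure_union, Submonoid.mem_sup] at ha
      obtain ⟨u, hu, c, hc, rfl⟩ := ha
      obtain ⟨k, rfl⟩ := Submonoid.mem_closure_singleton.mp hu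
      obtain ⟨j, hj, hh⟩ := aux_pow y p N m hm h k
      refine ⟨j, hj, _, ⟨c, hc, rfl⟩, ?_⟩
      funext b
      simp only
      rw [mul_assoc, hh, mul_left_comm]
  have h2 : ∀ a : M, ∃ h : S → S, ∃ c ∈ Submonoid.closure T, ∀ b, y (a * b) = h (y (c * b)) := by
    intro a
    have ha : a ∈ Submonoid.closure Pr := by rw [hgen]; trivial
    induction ha using Submonoid.closure_induction_left with
    | one => exact ⟨id, 1, one_mem _, fun b => rfl⟩
    | mul_left p hp a ha ih =>
      obtain ⟨h, c, hc, hh⟩ := ih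
      by_cases hpT : p ∈ T
      · refine ⟨h, p * c, mul_mem (Submonoid.subset_closure hpT) hc, fun b => ?_⟩
        have := hh (p * b)
        rw [mul_left_comm] at this
        rw [mul_assoc, this, mul_left_comm, mul_assoc]
      · obtain ⟨g, hg⟩ := hgood p hp hpT
        refine ⟨g ∘ h, c, hc, fun b => ?_⟩
        rw [mul_assoc, hg, hh]; rfl
  have h3 : (Set.image2 (fun (h : S → S) (z : M → S) => h ∘ z) Set.univ
    ((fun a : M => fun b : M => y (a * b)) '' (Submonoid.closure T : Set M))).Finite :=
    Set.Finite.image2 _ Set.finite_univ h1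
  refine h3.subset ?_
  rintro _ ⟨a, rfl⟩
  obtain ⟨h, c, hc, hh⟩ := h2 a
  exact ⟨h, trivial, _, ⟨c, hc, rfl⟩, by funext b; simp [hh]⟩

theorem aux_powdiff {B : Type*} [CommRing B] (P : Ideal B) (q c : ℕ) (hq : (q : B) ∈ P) (hc : 1 ≤ c)
    (x y : B) (h : x - y ∈ P ^ c) : x ^ q - y ^ q ∈ P ^ (c + 1) := by
  rw [← geom_sum₂_mul, pow_succ']
  refine Ideal.mul_mem_mul ?_ h
  have hxy : x - y ∈ P := Ideal.pow_le_self (by omega) h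
  rw [← Ideal.Quotient.eq_zero_iff_mem, RingHom.map_geom_sum₂]
  rw [← Ideal.Quotient.eq] at hxy
  rw [hxy, geom_sum₂_self]
  rw [← Ideal.Quotient.eq_zero_iff_mem, map_natCast] at hq
  rw [hq, zero_mul]

theorem aux_frob {A B : Type*} [CommRing A] [CommRing B] [Algebra A B] (p : Ideal A) (P : Ideal B)
    [p.IsMaximal] [P.IsMaximal] [P.LiesOver p] [Finite (B ⧸ P)] [Finite (A ⧸ p)] :
    ∃ f : ℕ, 0 < f ∧ ∀ y : B, y ^ (Nat.card (A ⧸ p) ^ f) - y ∈ P := by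
  let _ := Ideal.Quotient.field p
  let _ := Ideal.Quotient.field P
  have : Module.Finite (A ⧸ p) (B ⧸ P) := Module.Finite.of_finite
  refine ⟨Module.finrank (A ⧸ p) (B ⧸ P), Module.finrank_pos, fun y => ?_⟩
  have := Fintype.ofFinite (B ⧸ P)
  rw [← Module.natCard_eq_pow_finrank, ← Ideal.Quotient.eq_zero_iff_mem, map_sub, map_pow,
    Nat.card_eq_fintype_card, FiniteField.pow_card, sub_self]

theorem aux_unif {A : Type*} [CommRing A] [IsDedekindDomain A] (p : Ideal A) [p.IsPrime]
    (hp : p ≠ ⊥) : ∃ s π : A, s ∉ p ∧ π ∈ p ∧ π ≠ 0 ∧ ∀ r ∈ p, ∃ t, s * r = π * t := by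
  have hlt : p ^ 2 < p := by
    have := Ideal.pow_right_strictAnti p hp (Ideal.IsPrime.ne_top inferInstance)
      (show 1 < 2 by norm_num)
    simpa using this
  obtain ⟨π, hπ, hπ2⟩ := SetLike.exists_of_lt hlt
  have : p ∣ Ideal.span {π} := by
    rw [Ideal.dvd_span_singleton]; exact hπ
  obtain ⟨J, hJ⟩ := this
  have hJp : ¬ J ≤ p := by
    intro h
    apply hπ2
    have h1 : π ∈ p * J := hJ ▸ Ideal.mem_span_singleton_self π
    rw [pow_two]
    exact Ideal.mul_mono_right h h1
  obtain ⟨s, hs, hsp⟩ := SetLike.not_le_iff_exists.mp hJp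
  refine ⟨s, π, hsp, hπ, ?_, fun r hr => ?_⟩
  · rintro rfl; exact hπ2 (zero_mem _)
  · have : s * r ∈ Ideal.span {π} := by
      rw [hJ, mul_comm s r]; exact Ideal.mul_mem_mul hr hs
    exact Ideal.mem_span_singleton'.mp this |>.imp fun t ht => by rw [← ht, mul_comm]

theorem aux_gen {A : Type*} [CommRing A] [IsDedekindDomain A] :
    Submonoid.closure {x : NZI A | x.1.IsPrime} = ⊤ := by
  rw [eq_top_iff]
  rintro ⟨I, hI⟩ -
  induction I using UniqueFactorizationMonoid.induction_on_prime with
  | h₁ => exact absurd rfl hI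
  | h₂ x hx =>
    have : (⟨x, hI⟩ : NZI A) = 1 := Subtype.ext (by simpa using hx)
    rw [this]; exact one_mem _
  | h₃ a p ha hp ih =>
    have : (⟨p * a, hI⟩ : NZI A) = ⟨p, hp.ne_zero⟩ * ⟨a, ha⟩ := rfl
    rw [this]
    exact mul_mem (Submonoid.subset_closure (Ideal.isPrime_of_prime hp)) (ih ha)

theorem aux_bin {A X : Type*} [CommRing A] [CommRing X] [Algebra A X] (p : Ideal A)
    [p.IsMaximal] [Finite (A ⧸ p)] (S : Subalgebra A X) (x y : X) (hx : x ∈ S) (hy : y ∈ S) :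
    ∃ r ∈ p, ∃ η ∈ S,
      (x + y) ^ Nat.card (A ⧸ p) = x ^ Nat.card (A ⧸ p) + y ^ Nat.card (A ⧸ p) + r • η := by
  let _ := Ideal.Quotient.field p
  have := Fintype.ofFinite (A ⧸ p)
  obtain ⟨l, hl⟩ := CharP.exists (A ⧸ p)
  obtain ⟨n, hlp, hc⟩ := FiniteField.card (A ⧸ p) l
  obtain ⟨r, hr⟩ := exists_add_pow_prime_pow_eq hlp (⟨x, hx⟩ : S) ⟨y, hy⟩ n
  refine ⟨(l : A), ?_, x * y * r, mul_mem (mul_mem hx hy) r.2, ?_⟩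
  · rw [← Ideal.Quotient.eq_zero_iff_mem, map_natCast]; exact CharP.cast_eq_zero _ _
  · rw [Nat.card_eq_fintype_card, hc]
    have := congrArg Subtype.val hr
    simpa [Algebra.smul_def, mul_assoc] using this

theorem aux_USub (n : ℕ) : ∃ S : Subalgebra (𝓞 K) (NZI (𝓞 K) → Kbar K), (S : Set _) = USet K n := by
  induction n with
  | zero =>
    refine ⟨{ carrier := USet K 0, mul_mem' := ?_, add_mem' := ?_, algebraMap_mem' := ?_ }, rfl⟩
    · intro a b ha hb i; exact (ha i).mul (hb i)
    · intro a b ha hb i; exact (ha i).add (hb i)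
    · intro r i; exact isIntegral_algebraMap
  | succ n ih =>
    obtain ⟨S, hS⟩ := ih
    have hmem : ∀ x, x ∈ USet K n ↔ x ∈ S := fun x => by rw [← hS]; rfl
    have hms : ∀ (r : 𝓞 K) (y η : NZI (𝓞 K) → Kbar K), y * (r • η) = r • (y * η) := by
      intro r y η
      funext i
      exact Algebra.mul_smul_comm r (y i) (η i)
    have hM1 : ∀ (p : Ideal (𝓞 K)) (x y : NZI (𝓞 K) → Kbar K),
        x ∈ Submodule.span (𝓞 K) {x | ∃ r ∈ p, ∃ η ∈ USet K n, x = r • η} → y ∈ S →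
        y * x ∈ Submodule.span (𝓞 K) {x | ∃ r ∈ p, ∃ η ∈ USet K n, x = r • η} := by
      intro p x y hx hy
      induction hx using Submodule.span_induction with
      | mem x hx =>
        obtain ⟨r, hr, η, hη, rfl⟩ := hx
        refine Submodule.subset_span ⟨r, hr, y * η, (hmem _).2 (mul_mem hy ((hmem _).1 hη)), ?_⟩
        exact hms _ _ _
      | zero => rw [mul_zero]; exact zero_mem _
      | add u v _ _ hu hv => rw [mul_add]; exact add_mem hu hv
      | smul a u _ hu =>
        exact (congrArg (· ∈ Submodule.span (𝓞 K) {x | ∃ r ∈ p, ∃ η ∈ USet K n, x = r • η}) (hms a y u)).mpr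
          (Submodule.smul_mem _ a hu)
    have hM2 : ∀ (p : Ideal (𝓞 K)) (x : NZI (𝓞 K) → Kbar K),
        x ∈ Submodule.span (𝓞 K) {x | ∃ r ∈ p, ∃ η ∈ USet K n, x = r • η} → x ∈ S := by
      intro p x hx
      induction hx using Submodule.span_induction with
      | mem x hx =>
        obtain ⟨r, hr, η, hη, rfl⟩ := hx
        exact S.smul_mem ((hmem _).1 hη) r
      | zero => exact zero_mem _
      | add u v _ _ hu hv => exact add_mem hu hv
      | smul a u _ hu => exact S.smul_mem hu a
    have hone : ∀ (p : Ideal (𝓞 K)) (x : NZI (𝓞 K) → Kbar K), x ∈ S → ∀ r ∈ p, 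
        r • x ∈ Submodule.span (𝓞 K) {x | ∃ r ∈ p, ∃ η ∈ USet K n, x = r • η} :=
      fun p x hx r hr => Submodule.subset_span ⟨r, hr, x, (hmem _).2 hx, rfl⟩
    refine ⟨{ carrier := USet K (n + 1), mul_mem' := ?_, add_mem' := ?_, algebraMap_mem' := ?_ }, rfl⟩
    · rintro a b ⟨ha, ha'⟩ ⟨hb, hb'⟩
      rw [hmem] at ha hb
      refine ⟨(hmem _).2 (mul_mem ha hb), fun p hp hp0 => ?_⟩
      have e : shiftI ⟨p, hp0⟩ (a * b) - (a * b) ^ Ideal.absNorm p =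
        shiftI ⟨p, hp0⟩ b * (shiftI ⟨p, hp0⟩ a - a ^ Ideal.absNorm p) +
        a ^ Ideal.absNorm p * (shiftI ⟨p, hp0⟩ b - b ^ Ideal.absNorm p) := by
        have : shiftI ⟨p, hp0⟩ (a * b) = shiftI ⟨p, hp0⟩ a * shiftI ⟨p, hp0⟩ b := rfl
        rw [this]; ring
      rw [e]
      refine add_mem (hM1 _ _ _ (ha' p hp hp0) ?_) (hM1 _ _ _ (hb' p hp hp0) (pow_mem ha _))
      have := add_mem (hM2 _ _ (hb' p hp hp0)) (pow_mem hb (Ideal.absNorm p))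
      rwa [sub_add_cancel] at this
    · rintro a b ⟨ha, ha'⟩ ⟨hb, hb'⟩
      rw [hmem] at ha hb
      refine ⟨(hmem _).2 (add_mem ha hb), fun p hp hp0 => ?_⟩
      have := hp.isMaximal hp0
      have := Ideal.finiteQuotientOfFreeOfNeBot p hp0
      obtain ⟨r, hr, η, hη, hh'⟩ := aux_bin p S a b ha hb
      have hh : (a + b) ^ Nat.card (𝓞 K ⧸ p) =
        a ^ Nat.card (𝓞 K ⧸ p) + b ^ Nat.card (𝓞 K ⧸ p) + r • η := hh'
      have e : shiftI ⟨p, hp0⟩ (a + b) - (a + b) ^ Ideal.absNorm p =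
        (shiftI ⟨p, hp0⟩ a - a ^ Ideal.absNorm p) +
        (shiftI ⟨p, hp0⟩ b - b ^ Ideal.absNorm p) - r • η := by
        have h1 : shiftI ⟨p, hp0⟩ (a + b) = shiftI ⟨p, hp0⟩ a + shiftI ⟨p, hp0⟩ b := rfl
        have h2 : Ideal.absNorm p = Nat.card (𝓞 K ⧸ p) := rfl
        rw [h1, h2, hh]; generalize r • η = w; ring
      rw [e]
      exact sub_mem (add_mem (ha' p hp hp0) (hb' p hp hp0)) (hone _ _ hη _ hr)
    · intro c
      refine ⟨(hmem _).2 (S.algebraMap_mem c), fun p hp hp0 => ?_⟩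
      have := hp.isMaximal hp0
      have := Ideal.finiteQuotientOfFreeOfNeBot p hp0
      have e : shiftI ⟨p, hp0⟩ (algebraMap (𝓞 K) (NZI (𝓞 K) → Kbar K) c) -
        (algebraMap (𝓞 K) (NZI (𝓞 K) → Kbar K) c) ^ Ideal.absNorm p =
        (c - c ^ Ideal.absNorm p) • (1 : NZI (𝓞 K) → Kbar K) := by
        have h1 : shiftI ⟨p, hp0⟩ (algebraMap (𝓞 K) (NZI (𝓞 K) → Kbar K) c) =
          algebraMap (𝓞 K) (NZI (𝓞 K) → Kbar K) c := rfl
        rw [h1]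
        funext i
        change algebraMap (𝓞 K) (Kbar K) c - (algebraMap (𝓞 K) (Kbar K) c) ^ Ideal.absNorm p = _
        refine Eq.trans ?_ (Algebra.smul_def (c - c ^ Ideal.absNorm p) (1 : Kbar K)).symm
        rw [mul_one, map_sub, map_pow]
      rw [e]
      refine hone _ _ (one_mem _) _ ?_
      let _ := Ideal.Quotient.field p
      have := Fintype.ofFinite (𝓞 K ⧸ p)
      have h2 : Ideal.absNorm p = Nat.card (𝓞 K ⧸ p) := rfl
      rw [h2, ← Ideal.Quotient.eq_zero_iff_mem, map_sub, map_pow,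
        Nat.card_eq_fintype_card, FiniteField.pow_card, sub_self]

theorem aux_div (n : ℕ) (p : Ideal (𝓞 K)) (hp : p.IsPrime) (hp0 : p ≠ ⊥) (s π : 𝓞 K)
    (hs : ∀ r ∈ p, ∃ t, s * r = π * t) (ξ : NZI (𝓞 K) → Kbar K) (hξ : ξ ∈ USet K (n + 1)) :
    ∃ η ∈ USet K n, ∀ a, algebraMap (𝓞 K) (Kbar K) s * (ξ (⟨p, hp0⟩ * a) - ξ a ^ Ideal.absNorm p) =
      algebraMap (𝓞 K) (Kbar K) π * η a := by
  obtain ⟨S, hS⟩ := aux_USub K n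
  have hmem : ∀ x, x ∈ USet K n ↔ x ∈ S := fun x => by rw [← hS]; rfl
  have hsm : ∀ (r : 𝓞 K) (x : NZI (𝓞 K) → Kbar K) a, (r • x) a = algebraMap (𝓞 K) (Kbar K) r * x a :=
    fun r x a => Algebra.smul_def r (x a)
  have key : ∀ w ∈ Submodule.span (𝓞 K) {x | ∃ r ∈ p, ∃ η ∈ USet K n, x = r • η},
      ∃ η ∈ USet K n, ∀ a, algebraMap (𝓞 K) (Kbar K) s * w a =
      algebraMap (𝓞 K) (Kbar K) π * η a := by
    intro w h
    induction h using Submodule.span_induction with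
    | mem x hx =>
      obtain ⟨r, hr, η, hη, rfl⟩ := hx
      obtain ⟨t, ht⟩ := hs r hr
      refine ⟨t • η, (hmem _).2 (S.smul_mem ((hmem _).1 hη) t), fun a => ?_⟩
      rw [hsm, hsm, ← mul_assoc, ← mul_assoc, ← map_mul, ← map_mul, ht]
    | zero => exact ⟨0, (hmem _).2 (zero_mem _), by simp⟩
    | add u v _ _ hu hv =>
      obtain ⟨a, ha, ha'⟩ := hu
      obtain ⟨b, hb, hb'⟩ := hv
      refine ⟨a + b, (hmem _).2 (add_mem ((hmem _).1 ha) ((hmem _).1 hb)), fun i => ?_⟩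
      rw [Pi.add_apply, Pi.add_apply, mul_add, mul_add, ha', hb']
    | smul c u _ hu =>
      obtain ⟨a, ha, ha'⟩ := hu
      refine ⟨c • a, (hmem _).2 (S.smul_mem ((hmem _).1 ha) c), fun i => ?_⟩
      rw [hsm, mul_left_comm, ← ha', mul_left_comm]
      exact congrArg _ (hsm c u i)
  exact key _ (hξ.2 p hp hp0)

theorem aux_USet_int (n : ℕ) (ξ : NZI (𝓞 K) → Kbar K) (h : ξ ∈ USet K n) (a) :
    IsIntegral (𝓞 K) (ξ a) := by
  induction n with
  | zero => exact h a
  | succ n ih => exact ih h.1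

/-- lifting of the division to `B`. -/
theorem aux_divB {B : Type*} [CommRing B] [Algebra (𝓞 K) B]
    (φ : B →ₐ[𝓞 K] Kbar K) (hφ : Function.Injective φ)
    (hrange : ∀ x : Kbar K, IsIntegral (𝓞 K) x → ∀ r : 𝓞 K, r ≠ 0 → algebraMap (𝓞 K) (Kbar K) r * x ∈ φ.range → x ∈ φ.range)
    (n : ℕ) (p : Ideal (𝓞 K)) (hp : p.IsPrime) (hp0 : p ≠ ⊥) (s π : 𝓞 K) (hπ : π ≠ 0)
    (hs : ∀ r ∈ p, ∃ t, s * r = π * t) (y : NZI (𝓞 K) → B) (hy : (fun a => φ (y a)) ∈ USet K (n + 1)) :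
    ∃ z : NZI (𝓞 K) → B, (fun a => φ (z a)) ∈ USet K n ∧ 
      ∀ a, algebraMap (𝓞 K) B s * (y (⟨p, hp0⟩ * a) - y a ^ Ideal.absNorm p) = algebraMap (𝓞 K) B π * z a := by
  obtain ⟨η, hη, h⟩ := aux_div K n p hp hp0 s π hs _ hy
  have h' : ∀ a, φ (algebraMap (𝓞 K) B s * (y (⟨p, hp0⟩ * a) - y a ^ Ideal.absNorm p)) = algebraMap (𝓞 K) (Kbar K) π * η a := by
    intro a
    rw [map_mul, map_sub, map_pow, φ.commutes]
    exact h a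
  have h3 : ∀ a, ∃ z, φ z = η a := by
    intro a
    refine hrange _ (aux_USet_int K n η hη a) π hπ ?_
    rw [← h']
    exact ⟨_, rfl⟩
  choose z hz using h3
  refine ⟨z, ?_, fun a => hφ ?_⟩
  · simpa [hz] using hη
  · rw [h', map_mul, hz, φ.commutes]

theorem aux_cong1 {B : Type*} [CommRing B] [Algebra (𝓞 K) B]
    (φ : B →ₐ[𝓞 K] Kbar K) (hφ : Function.Injective φ)
    (hrange : ∀ x : Kbar K, IsIntegral (𝓞 K) x → ∀ r : 𝓞 K, r ≠ 0 → algebraMap (𝓞 K) (Kbar K) r * x ∈ φ.range → x ∈ φ.range)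
    (p : Ideal (𝓞 K)) (hp : p.IsPrime) (hp0 : p ≠ ⊥) (P : Ideal B) [P.IsPrime] [P.LiesOver p]
    (y : NZI (𝓞 K) → B) (hy : (fun a => φ (y a)) ∈ USet K 1) (a : NZI (𝓞 K)) :
    y (⟨p, hp0⟩ * a) - y a ^ Ideal.absNorm p ∈ P := by
  obtain ⟨s, π, hs, hπ, hπ0, hsπ⟩ := aux_unif p hp0
  obtain ⟨z, hz, h⟩ := aux_divB K φ hφ hrange 0 p hp hp0 s π hπ0 hsπ y hy
  have := h a
  rw [Ideal.mem_of_liesOver P p] at hs hπ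
  have h2 := P.mul_mem_right (z a) hπ
  rw [← this] at h2
  exact (Ideal.IsPrime.mem_or_mem inferInstance h2).resolve_left hs

theorem aux_cong {B : Type*} [CommRing B] [IsDedekindDomain B] [Algebra (𝓞 K) B]
    (φ : B →ₐ[𝓞 K] Kbar K) (hφ : Function.Injective φ)
    (hrange : ∀ x : Kbar K, IsIntegral (𝓞 K) x → ∀ r : 𝓞 K, r ≠ 0 → algebraMap (𝓞 K) (Kbar K) r * x ∈ φ.range → x ∈ φ.range)
    (p : Ideal (𝓞 K)) (hp : p.IsPrime) (hp0 : p ≠ ⊥) (P : Ideal B) [P.IsPrime] [P.LiesOver p]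
    (f : ℕ) (hf : ∀ y : B, y ^ (Ideal.absNorm p ^ f) - y ∈ P) (c : ℕ)
    (y : NZI (𝓞 K) → B) (hy : (fun a => φ (y a)) ∈ USet K (c + 1)) (a : NZI (𝓞 K)) :
    y (⟨p, hp0⟩ ^ (c + f) * a) - y (⟨p, hp0⟩ ^ c * a) ∈ P ^ (c + 1) := by
  induction c generalizing y a with
  | zero =>
    simp only [zero_add, pow_zero, one_mul, pow_one]
    have key : ∀ k a, y (⟨p, hp0⟩ ^ k * a) - y a ^ (Ideal.absNorm p ^ k) ∈ P := by
      intro k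
      induction k with
      | zero => simp
      | succ k ih =>
        intro a
        have h1 := ih (⟨p, hp0⟩ * a)
        have h2 := aux_cong1 K φ hφ hrange p hp hp0 P y hy a
        rw [← Ideal.Quotient.eq] at h1 h2 ⊢
        rw [map_pow] at h1 h2
        rw [pow_succ, mul_assoc, h1, h2, ← map_pow, ← map_pow, ← pow_mul, pow_succ, mul_comm]
    have := add_mem (key f a) (hf (y a))
    rwa [sub_add_sub_cancel] at this
  | succ c ih =>
    obtain ⟨s, π, hs, hπ, hπ0, hsπ⟩ := aux_unif p hp0
    obtain ⟨z, hz, h⟩ := aux_divB K φ hφ hrange (c + 1) p hp hp0 s π hπ0 hsπ y hy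
    rw [Ideal.mem_of_liesOver P p] at hs hπ
    refine (Ideal.IsPrime.mul_mem_pow P (a := algebraMap _ _ s) ?_).resolve_left hs
    have i1 := ih y hy.1 a
    have i2 := ih z hz a
    have hq : ((Ideal.absNorm p : ℕ) : B) ∈ P := by
      have := Ideal.absNorm_mem p
      rw [Ideal.mem_of_liesOver P p] at this
      simpa using this
    have i3 := aux_powdiff P _ _ hq (by omega) _ _ i1
    have i4 : algebraMap (𝓞 K) B π * (z (⟨p, hp0⟩ ^ (c + f) * a) - z (⟨p, hp0⟩ ^ c * a)) ∈
        P ^ (c + 1 + 1) := by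
      rw [pow_succ' _ (c + 1)]; exact Ideal.mul_mem_mul hπ i2
    have e1 := h (⟨p, hp0⟩ ^ (c + f) * a)
    have e2 := h (⟨p, hp0⟩ ^ c * a)
    rw [← mul_assoc, ← pow_succ'] at e1 e2
    rw [show c + 1 + f = c + f + 1 by ring]
    have := add_mem (Ideal.mul_mem_left _ (algebraMap (𝓞 K) B s) i3) i4
    convert this using 1
    rw [mul_sub, mul_sub, mul_sub, ← e1, ← e2]; ring

theorem aux_main {B : Type*} [CommRing B] [IsDedekindDomain B] [Algebra (𝓞 K) B]
    [Algebra.IsIntegral (𝓞 K) B] (hfin : ∀ P : Ideal B, P ≠ ⊥ → Finite (B ⧸ P))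
    (φ : B →ₐ[𝓞 K] Kbar K) (hφ : Function.Injective φ)
    (hrange : ∀ x : Kbar K, IsIntegral (𝓞 K) x → ∀ r : 𝓞 K, r ≠ 0 → algebraMap (𝓞 K) (Kbar K) r * x ∈ φ.range → x ∈ φ.range)
    (y : NZI (𝓞 K) → B) (hy : ∀ n, (fun a => φ (y a)) ∈ USet K n) (hyfin : (Set.range y).Finite) :
    (Set.range (fun a : NZI (𝓞 K) => fun b => y (a * b))).Finite := by
  classical
  have hA : Function.Injective (algebraMap (𝓞 K) B) := by
    have h1 : Function.Injective (algebraMap (𝓞 K) (Kbar K)) :=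
      FaithfulSMul.algebraMap_injective _ _
    intro a b hab
    apply h1
    rw [← φ.commutes, ← φ.commutes, hab]
  have : FaithfulSMul (𝓞 K) B := (faithfulSMul_iff_algebraMap_injective _ _).2 hA
  have hover : ∀ p : Ideal (𝓞 K), p.IsPrime → p ≠ ⊥ → ∃ P : Ideal B, P.IsMaximal ∧ P.LiesOver p ∧
      P ≠ ⊥ := by
    intro p hp hp0
    have := hp.isMaximal hp0
    obtain ⟨P, h1, h2⟩ := Ideal.exists_maximal_ideal_liesOver_of_isIntegral (S := B) p
    exact ⟨P, h1, h2, Ideal.ne_bot_of_liesOver_of_ne_bot hp0 P⟩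
  have : Finite (Set.range y) := hyfin
  let S := Set.range y
  -- discriminant
  let D : Finset B := (Finset.image₂ (fun a b => a - b) hyfin.toFinset hyfin.toFinset).erase 0
  have hD : ∀ a b, y a ≠ y b → y a - y b ∈ D := by
    intro a b hab
    refine Finset.mem_erase.2 ⟨sub_ne_zero.2 hab, Finset.mem_image₂.2 ⟨y a, by simp, y b, by simp, rfl⟩⟩
  let d : B := ∏ x ∈ D, x
  have hd : d ≠ 0 := Finset.prod_ne_zero_iff.2 fun x hx => Finset.ne_of_mem_erase hx
  let J : Ideal (𝓞 K) := (Ideal.span {d}).comap (algebraMap (𝓞 K) B)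
  have hJ : J ≠ ⊥ := Ideal.comap_ne_bot_of_integral_mem hd (Ideal.mem_span_singleton_self d)
    (Algebra.IsIntegral.isIntegral d)
  let T : Set (NZI (𝓞 K)) := {x | x.1.IsPrime ∧ J ≤ x.1}
  have hT : T.Finite := by
    have h := Ideal.finite_factors hJ
    refine Set.Finite.of_finite_image (f := fun x => x.1) ?_ Subtype.val_injective.injOn
    refine (h.image (fun v => v.asIdeal)).subset ?_
    rintro _ ⟨x, ⟨hx, hx'⟩, rfl⟩
    exact ⟨⟨x.1, hx, x.2⟩, Ideal.dvd_iff_le.2 hx', rfl⟩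
  let y' : NZI (𝓞 K) → S := fun a => ⟨y a, a, rfl⟩
  have main := aux_comb y' {x | x.1.IsPrime} T aux_gen hT ?_ ?_
  · refine (main.image (fun z => fun b => (z b : B))).subset ?_
    rintro _ ⟨a, rfl⟩
    exact ⟨_, ⟨a, rfl⟩, rfl⟩
  · rintro ⟨p, hp0⟩ hp hpT
    replace hp : p.IsPrime := hp
    obtain ⟨P, hP, hPp, hPb⟩ := hover p hp hp0
    have hPp' := hP.isPrime
    have hinj : ∀ a b, y' a = y' b → y' (⟨p, hp0⟩ * a) = y' (⟨p, hp0⟩ * b) := by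
      intro a b hab
      have hab : y a = y b := congrArg Subtype.val hab
      by_contra hne
      have hne : y (⟨p, hp0⟩ * a) ≠ y (⟨p, hp0⟩ * b) := fun h => hne (Subtype.ext h)
      apply hpT
      refine ⟨hp, fun r hr => ?_⟩
      have h1 := aux_cong1 K φ hφ hrange p hp hp0 P y (hy 1) a
      have h2 := aux_cong1 K φ hφ hrange p hp hp0 P y (hy 1) b
      rw [hab] at h1
      have h3 := sub_mem h1 h2
      rw [sub_sub_sub_cancel_right] at h3
      rw [Ideal.mem_of_liesOver P p]
      have h4 : d ∈ P := Ideal.mem_of_dvd _ (Finset.dvd_prod_of_mem _ (hD _ _ hne)) h3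
      exact (Ideal.span_singleton_le_iff_mem P).2 h4 hr
    refine ⟨fun t => y' (⟨p, hp0⟩ * t.2.choose), fun a => ?_⟩
    apply hinj
    exact Subtype.ext (y' a).2.choose_spec.symm
  · rintro ⟨p, hp0⟩ ⟨hp, -⟩
    replace hp : p.IsPrime := hp
    obtain ⟨P, hP, hPp, hPb⟩ := hover p hp hp0
    have hPp' := hP.isPrime
    have := hp.isMaximal hp0
    have := hfin P hPb
    have := Ideal.finiteQuotientOfFreeOfNeBot p hp0
    obtain ⟨f, hf0, hf⟩ := aux_frob p P
    have hc : ∃ c : ℕ, d ∉ P ^ c := by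
      by_contra! h
      have h2 : d ∈ ⨅ i, P ^ i := (Submodule.mem_iInf _).2 h
      rw [Ideal.iInf_pow_eq_bot_of_isDomain P hP.ne_top] at h2
      exact hd h2
    obtain ⟨c, hc⟩ := hc
    refine ⟨c, f, hf0, fun a => Subtype.ext ?_⟩
    by_contra hne
    have h1 := aux_cong K φ hφ hrange p hp hp0 P f hf c y (hy _) a
    exact hc (Ideal.pow_le_pow_right (Nat.le_succ c) (Ideal.mem_of_dvd _ (Finset.dvd_prod_of_mem _ (hD _ _ hne)) h1))


theorem aux_eval (f : Polynomial (𝓞 K)) (ξ : NZI (𝓞 K) → Kbar K) (a : NZI (𝓞 K)) :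
    (f.eval₂ (algebraMap (𝓞 K) (NZI (𝓞 K) → Kbar K)) ξ) a =
      f.eval₂ (algebraMap (𝓞 K) (Kbar K)) (ξ a) :=
  Polynomial.hom_eval₂ f (algebraMap (𝓞 K) (NZI (𝓞 K) → Kbar K))
    (Pi.evalRingHom (fun _ : NZI (𝓞 K) => Kbar K) a) ξ

theorem aux_forward (ξ : NZI (𝓞 K) → Kbar K) (hξ : ∀ n, ξ ∈ USet K n)
    (hfin : (Set.range ξ).Finite) :
    Set.Finite {η : NZI (𝓞 K) → Kbar K | ∃ a : NZI (𝓞 K), η = shiftI a ξ} := by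
  have hint : ∀ a, IsIntegral (𝓞 K) (ξ a) := aux_USet_int K 0 ξ (hξ 0)
  let L := IntermediateField.adjoin K (Set.range ξ)
  have hfd : FiniteDimensional K L := by
    have : Finite (Set.range ξ) := hfin
    apply IntermediateField.finiteDimensional_adjoin
    rintro _ ⟨a, rfl⟩
    exact (Algebra.IsAlgebraic.isAlgebraic (ξ a)).isIntegral
  have hnf : NumberField L := NumberField.of_module_finite K L
  let φ : 𝓞 L →ₐ[𝓞 K] Kbar K :=
    { (algebraMap L (Kbar K)).comp (algebraMap (𝓞 L) L) with
      commutes' := fun r => rfl }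
  have hφ : Function.Injective φ :=
    (algebraMap L (Kbar K)).injective.comp RingOfIntegers.coe_injective
  have hlift : ∀ x : Kbar K, x ∈ L → IsIntegral (𝓞 K) x → ∃ z, φ z = x := by
    intro x hx hi
    have h1 : IsIntegral ℤ x := isIntegral_trans (R := ℤ) (A := 𝓞 K) x hi
    have h2 : IsIntegral ℤ (⟨x, hx⟩ : L) :=
      (isIntegral_algHom_iff (IsScalarTower.toAlgHom ℤ L (Kbar K))
        (algebraMap L (Kbar K)).injective).1 h1
    exact ⟨⟨_, h2⟩, rfl⟩
  have hmemL : ∀ z, φ z ∈ L := fun z => (algebraMap (𝓞 L) L z).2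
  have hrange : ∀ x : Kbar K, IsIntegral (𝓞 K) x → ∀ r : 𝓞 K, r ≠ 0 →
      algebraMap (𝓞 K) (Kbar K) r * x ∈ φ.range → x ∈ φ.range := by
    rintro x hx r hr ⟨z, hz⟩
    refine hlift x ?_ hx
    have hr0 : algebraMap (𝓞 K) (Kbar K) r ≠ 0 :=
      (map_ne_zero_iff _ (FaithfulSMul.algebraMap_injective (𝓞 K) (Kbar K))).2 hr
    have hrL : algebraMap (𝓞 K) (Kbar K) r ∈ L := by
      rw [← φ.commutes]; exact hmemL _
    have h1 : algebraMap (𝓞 K) (Kbar K) r * x ∈ L := by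
      rw [← hz]; exact hmemL z
    have := L.mul_mem (L.inv_mem hrL) h1
    rwa [inv_mul_cancel_left₀ hr0] at this
  have h3 : ∀ a, ∃ z, φ z = ξ a := fun a =>
    hlift _ (IntermediateField.subset_adjoin _ _ ⟨a, rfl⟩) (hint a)
  choose y hy using h3
  have hyξ : (fun a => φ (y a)) = ξ := funext hy
  have hyfin : (Set.range y).Finite := by
    refine Set.Finite.of_finite_image (f := φ) ?_ hφ.injOn
    rw [← Set.range_comp]
    change (Set.range (fun a => φ (y a))).Finite
    rwa [hyξ]
  have main := aux_main K (B := 𝓞 L) (fun P hP => Ideal.finiteQuotientOfFreeOfNeBot P hP)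
    φ hφ hrange y (by rw [hyξ]; exact hξ) hyfin
  refine (main.image (fun z => fun b => φ (z b))).subset ?_
  rintro _ ⟨a, rfl⟩
  exact ⟨_, ⟨a, rfl⟩, funext fun b => hy _⟩

/-- arithmetic analogue of Christol's theorem. A Witt vector
`ξ ∈ W_{O_K}(O_K̄)` is integral over `O_K` if and only if its orbit
`{ψ_𝔞 ξ : 𝔞 ∈ I_K}` under the shift operators is finite. -/
theorem isIntegral_iff_orbit_finite
    (ξ : NZI (𝓞 K) → Kbar K) (hξ : ∀ n, ξ ∈ USet K n) :
    IsIntegral (𝓞 K) ξ ↔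
      Set.Finite {η : NZI (𝓞 K) → Kbar K | ∃ a : NZI (𝓞 K), η = shiftI a ξ} := by
  constructor
  · rintro ⟨f, hf, h⟩
    refine aux_forward K ξ hξ ?_
    have hm : f.map (algebraMap (𝓞 K) (Kbar K)) ≠ 0 := (hf.map _).ne_zero
    refine (Polynomial.finite_setOf_isRoot hm).subset ?_
    rintro _ ⟨a, rfl⟩
    have h1 := aux_eval K f ξ a
    rw [h] at h1
    change (f.map (algebraMap (𝓞 K) (Kbar K))).eval (ξ a) = 0
    rw [Polynomial.eval_map, ← h1]
    rfl
  · intro hfin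
    have hr : (Set.range ξ).Finite := by
      refine (hfin.image (fun η => η 1)).subset ?_
      rintro _ ⟨a, rfl⟩
      exact ⟨_, ⟨a, rfl⟩, by simp [shiftI]⟩
    have hint : ∀ a, IsIntegral (𝓞 K) (ξ a) := aux_USet_int K 0 ξ (hξ 0)
    choose g hg hg' using hint
    classical
    have hex : ∀ x ∈ hr.toFinset, ∃ g : Polynomial (𝓞 K), g.Monic ∧
        g.eval₂ (algebraMap (𝓞 K) (Kbar K)) x = 0 := by
      intro x hx
      obtain ⟨a, rfl⟩ := hr.mem_toFinset.1 hx
      exact ⟨g a, hg a, hg' a⟩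
    choose! G hG hG' using hex
    refine ⟨∏ x ∈ hr.toFinset, G x, Polynomial.monic_prod_of_monic _ _ hG, ?_⟩
    funext a
    rw [aux_eval, Polynomial.eval₂_finsetProd]
    have ha : ξ a ∈ hr.toFinset := by simp
    exact Finset.prod_eq_zero ha (hG' _ ha)
end

section
/- For every γ ∈ ℚ, the vector ζ^(γ) = (e^{2πiγn})_{n≥1} is an integral Witt vector over ℤ: it lies in U_k for every k ≥ 0 (hence ζ^(γ) ∈ W_ℤ(ℤ̄)), and ζ^(γ) is integral over ℤ as an element of the ring ℂ^{ℕ≥1}. -/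
open scoped Real

/-- The sets `U_k` in the inductive construction of `W_ℤ(ℤ̄) ⊆ ℂ^{ℕ≥1}`:
`U_0` consists of the vectors whose entries are integral over `ℤ` (i.e. lie in `ℤ̄`),
and `U_{k+1}` consists of those `ξ ∈ U_k` such that for every prime `p` the vector
`ψ_p ξ - ξ^p = (ξ_{pn} - ξ_n^p)_n` lies in the ℤ-submodule generated by `{p·η : η ∈ U_k}`. -/
def UQ : ℕ → Set (ℕ+ → ℂ)
  | 0 => {ξ | ∀ n, IsIntegral ℤ (ξ n)}
  | k + 1 =>
      {ξ | ξ ∈ UQ k ∧ ∀ (p : ℕ) (hp : p.Prime),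
        (fun n => ξ (⟨p, hp.pos⟩ * n)) - ξ ^ p ∈
          Submodule.span ℤ {x | ∃ η ∈ UQ k, x = (p : ℤ) • η}}

/-- The set `W^a_ℤ(ℤ̄)` of integral Witt vectors over `ℤ`: elements of
`W_ℤ(ℤ̄) = ⋂ k, U_k` that are integral over `ℤ` as elements of `ℂ^{ℕ≥1}`. -/
def WaQ : Set (ℕ+ → ℂ) := {ξ | (∀ k, ξ ∈ UQ k) ∧ IsIntegral ℤ ξ}

/-- The vector `ζ^(γ) = (e^{2πiγn})_{n ≥ 1}`. -/
noncomputable def zetaVec (γ : ℚ) : ℕ+ → ℂ :=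
  fun n => Complex.exp (2 * π * Complex.I * (γ : ℂ) * (n : ℂ))

theorem zetaVec_pow_den (γ : ℚ) : zetaVec γ ^ γ.den = 1 := by
  funext n
  simp only [zetaVec, Pi.pow_apply, Pi.one_apply]
  rw [← Complex.exp_nat_mul, Complex.exp_eq_one_iff]
  refine ⟨γ.num * (n : ℕ), ?_⟩
  have h : (γ : ℂ) * (γ.den : ℂ) = (γ.num : ℂ) := by
    exact_mod_cast congrArg (fun q : ℚ => (q : ℂ)) (Rat.mul_den_eq_num γ)
  push_cast
  rw [← h]
  ring

theorem zetaVec_mul (γ : ℚ) (p : ℕ) (q : ℕ+) (hq : (q : ℕ) = p) (n : ℕ+) :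
    zetaVec γ (q * n) = (zetaVec γ ^ p) n := by
  subst hq
  simp only [zetaVec, Pi.pow_apply]
  rw [← Complex.exp_nat_mul]
  congr 1
  rw [PNat.mul_coe, Nat.cast_mul]
  ring

theorem zetaVec_integral (γ : ℚ) : IsIntegral ℤ (zetaVec γ) := by
  apply IsIntegral.of_pow γ.den_pos
  rw [zetaVec_pow_den]
  exact isIntegral_one

/-- For every `γ ∈ ℚ`, the vector `ζ^(γ)` lies in `U_k` for every `k`
(hence `ζ^(γ) ∈ W_ℤ(ℤ̄)`) and is integral over `ℤ` as an element of `ℂ^{ℕ≥1}`;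
that is, `ζ^(γ)` is an integral Witt vector over `ℤ`. -/
theorem zetaVec_mem_WaQ (γ : ℚ) : (∀ k, zetaVec γ ∈ UQ k) ∧ IsIntegral ℤ (zetaVec γ) := by
  refine ⟨fun k => ?_, zetaVec_integral γ⟩
  induction k with
  | zero =>
    intro n
    apply IsIntegral.of_pow γ.den_pos
    have := congrFun (zetaVec_pow_den γ) n
    rw [Pi.pow_apply] at this
    rw [this]
    exact isIntegral_one
  | succ k ih =>
    refine ⟨ih, fun p hp => ?_⟩
    have : (fun n => zetaVec γ (⟨p, hp.pos⟩ * n)) - zetaVec γ ^ p = 0 := by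
      rw [sub_eq_zero]
      funext n
      exact zetaVec_mul γ p _ rfl n
    rw [this]
    exact Submodule.zero_mem _
end
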